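/- Let d ∈ ℕ and let V : ℝ^d → ℝ be Borel measurable. (i) If S(V,t,x,y) < ∞ for some t > 0 and x, y ∈ ℝ^d, then V is locally integrable on ℝ^d. (ii) For every t > 0 and x ∈ ℝ^d one has the identity ∫_{ℝ^d} S(V,t,x,y) g(t,x,y) dy = ∫₀ᵗ ∫_{ℝ^d} g(s,x,z) |V(z)| dz ds. (iii) Consequently, if sup_{0<t≤T, x,y∈ℝ^d} S(V,t,x,y) < ∞ for some T ∈ (0,∞), then sup_{x∈ℝ^d} ∫₀^T ∫_{ℝ^d} g(s,x,z) |V(z)| dz ds < ∞; and if ‖S(V)‖_∞ < ∞, then sup_{x∈ℝ^d} ∫₀^∞ ∫_{ℝ^d} g(s,x,z) |V(z)| dz ds < ∞. -/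

import Mathlib

open MeasureTheory Real
open scoped ENNReal

/-- The Gauss–Weierstrass kernel on `ℝ^d`. -/
noncomputable def gk (d : ℕ) (t : ℝ) (x y : EuclideanSpace ℝ (Fin d)) : ℝ :=
  (4 * Real.pi * t) ^ (-(d : ℝ) / 2) * Real.exp (-‖y - x‖ ^ 2 / (4 * t))

/-- `S(V,t,x,y)`, the potential of `|V|` for the Gaussian bridges. -/
noncomputable def Sv (d : ℕ) (V : EuclideanSpace ℝ (Fin d) → ℝ) (t : ℝ)
    (x y : EuclideanSpace ℝ (Fin d)) : ℝ≥0∞ :=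
  ∫⁻ s in Set.Ioo 0 t, ∫⁻ z,
    ENNReal.ofReal (gk d s x z * gk d (t - s) z y / gk d t x y * |V z|)

theorem gk_pos (d : ℕ) {t : ℝ} (ht : 0 < t) (x y : EuclideanSpace ℝ (Fin d)) :
    0 < gk d t x y := by
  unfold gk; positivity

theorem continuous_gk_right (d : ℕ) (t : ℝ) (x : EuclideanSpace ℝ (Fin d)) :
    Continuous fun y => gk d t x y := by
  unfold gk; fun_prop

theorem continuous_gk_left (d : ℕ) (t : ℝ) (y : EuclideanSpace ℝ (Fin d)) :
    Continuous fun x => gk d t x y := by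
  unfold gk; fun_prop

theorem measurable_gk (d : ℕ) : Measurable fun p : ℝ × EuclideanSpace ℝ (Fin d) ×
    EuclideanSpace ℝ (Fin d) => gk d p.1 p.2.1 p.2.2 := by
  unfold gk; fun_prop

theorem Measurable.gk {α : Type*} [MeasurableSpace α] {d : ℕ} {t : α → ℝ}
    {x y : α → EuclideanSpace ℝ (Fin d)} (ht : Measurable t) (hx : Measurable x)
    (hy : Measurable y) : Measurable fun a => gk d (t a) (x a) (y a) :=
  (measurable_gk d).comp (ht.prodMk (hx.prodMk hy))

theorem lintegral_gk (d : ℕ) {t : ℝ} (ht : 0 < t) (x : EuclideanSpace ℝ (Fin d)) :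
    ∫⁻ y, ENNReal.ofReal (gk d t x y) = 1 := by
  have h0 : ∫ v : EuclideanSpace ℝ (Fin d), gk d t 0 v = 1 := by
    have h := GaussianFourier.integral_rexp_neg_mul_sq_norm (V := EuclideanSpace ℝ (Fin d))
      (b := 1 / (4 * t)) (by positivity)
    have e : ∀ v : EuclideanSpace ℝ (Fin d), gk d t 0 v =
        (4 * Real.pi * t) ^ (-(d : ℝ) / 2) * Real.exp (-(1 / (4 * t)) * ‖v‖ ^ 2) := by
      intro v
      unfold gk
      rw [sub_zero]
      congr 2
      ring
    simp_rw [e]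
    rw [integral_const_mul, h, finrank_euclideanSpace_fin, div_div_eq_mul_div, div_one,
      show Real.pi * (4 * t) = 4 * Real.pi * t by ring, ← Real.rpow_add (by positivity),
      neg_div, neg_add_cancel, Real.rpow_zero]
  have hi : Integrable fun v : EuclideanSpace ℝ (Fin d) => gk d t 0 v := by
    by_contra hn
    rw [integral_undef hn] at h0
    exact zero_ne_one h0
  have hx : ∀ y, gk d t x y = gk d t 0 (y - x) := by
    intro y; simp [gk]
  simp_rw [hx]
  rw [lintegral_sub_right_eq_self (fun v => ENNReal.ofReal (gk d t 0 v)),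
    ← ofReal_integral_eq_lintegral_ofReal hi (ae_of_all _ fun v => (gk_pos d ht 0 v).le), h0,
    ENNReal.ofReal_one]

theorem locallyIntegrable_of_Sv_lt_top {d : ℕ} {V : EuclideanSpace ℝ (Fin d) → ℝ}
    (hV : Measurable V) {t : ℝ} (ht : 0 < t) {x y : EuclideanSpace ℝ (Fin d)}
    (h : Sv d V t x y < ⊤) : LocallyIntegrable V volume := by
  obtain ⟨s, hs, hfin⟩ : ∃ s ∈ Set.Ioo 0 t, ∫⁻ z,
      ENNReal.ofReal (gk d s x z * gk d (t - s) z y / gk d t x y * |V z|) < ⊤ := by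
    by_contra! hn
    have : Sv d V t x y = ⊤ := by
      rw [Sv, setLIntegral_congr_fun measurableSet_Ioo fun s hs => top_le_iff.1 (hn s hs)]
      simp [ht]
    exact h.ne this
  set w : EuclideanSpace ℝ (Fin d) → ℝ := fun z => gk d s x z * gk d (t - s) z y / gk d t x y
  have hwc : Continuous w :=
    ((continuous_gk_right d s x).mul (continuous_gk_left d (t - s) y)).div_const _
  have hw : ∀ z, 0 < w z := fun z =>
    div_pos (mul_pos (gk_pos d hs.1 x z) (gk_pos d (sub_pos.2 hs.2) z y)) (gk_pos d ht x y)
  have hint : Integrable (fun z => w z * V z) := by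
    refine ⟨(hwc.measurable.mul hV).aestronglyMeasurable, ?_⟩
    rw [hasFiniteIntegral_iff_norm]
    simpa only [norm_mul, Real.norm_eq_abs, abs_of_pos (hw _)] using hfin
  rw [locallyIntegrable_iff]
  intro K hK
  have hwi : ContinuousOn (fun z => (w z)⁻¹) K :=
    (hwc.inv₀ fun z => (hw z).ne').continuousOn
  refine (hint.integrableOn.continuousOn_mul hwi hK).congr_fun (fun z _ => ?_) hK.measurableSet
  exact inv_mul_cancel_left₀ (hw z).ne' _

theorem lintegral_lintegral_lintegral_rotate {α β γ : Type*} [MeasurableSpace α]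
    [MeasurableSpace β] [MeasurableSpace γ] {μ : Measure α} {ν : Measure β} {ρ : Measure γ}
    [SFinite μ] [SFinite ν] [SFinite ρ] {f : α → β → γ → ℝ≥0∞}
    (hf : Measurable fun p : (α × β) × γ => f p.1.1 p.1.2 p.2) :
    ∫⁻ a, ∫⁻ b, ∫⁻ c, f a b c ∂ρ ∂ν ∂μ = ∫⁻ b, ∫⁻ c, ∫⁻ a, f a b c ∂μ ∂ρ ∂ν := by
  rw [lintegral_lintegral_swap hf.lintegral_prod_right'.aemeasurable]
  refine lintegral_congr fun b => lintegral_lintegral_swap (Measurable.aemeasurable ?_)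
  exact hf.comp ((measurable_fst.prodMk measurable_const).prodMk measurable_snd)

theorem lintegral_Sv_mul_gk {d : ℕ} {V : EuclideanSpace ℝ (Fin d) → ℝ} (hV : Measurable V)
    {t : ℝ} (ht : 0 < t) (x : EuclideanSpace ℝ (Fin d)) :
    ∫⁻ y, Sv d V t x y * ENNReal.ofReal (gk d t x y) =
      ∫⁻ s in Set.Ioo 0 t, ∫⁻ z, ENNReal.ofReal (gk d s x z * |V z|) := by
  have hSv : ∀ y, Sv d V t x y * ENNReal.ofReal (gk d t x y) =
      ∫⁻ s in Set.Ioo 0 t, ∫⁻ z,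
        ENNReal.ofReal (gk d s x z * |V z|) * ENNReal.ofReal (gk d (t - s) z y) := by
    intro y
    rw [Sv, ← lintegral_mul_const' _ _ ENNReal.ofReal_ne_top]
    refine setLIntegral_congr_fun measurableSet_Ioo fun s hs => ?_
    rw [← lintegral_mul_const' _ _ ENNReal.ofReal_ne_top]
    refine lintegral_congr fun z => ?_
    rw [← ENNReal.ofReal_mul' (gk_pos d ht x y).le,
      ← ENNReal.ofReal_mul' (gk_pos d (sub_pos.2 hs.2) z y).le]
    congr 1
    have := (gk_pos d ht x y).ne'
    field_simp
  have hm : Measurable fun p : (EuclideanSpace ℝ (Fin d) × ℝ) × EuclideanSpace ℝ (Fin d) =>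
      ENNReal.ofReal (gk d p.1.2 x p.2 * |V p.2|) *
        ENNReal.ofReal (gk d (t - p.1.2) p.2 p.1.1) := by
    refine Measurable.mul (Measurable.ennreal_ofReal (Measurable.mul ?_ ?_))
      (Measurable.ennreal_ofReal ?_)
    · exact Measurable.gk (by fun_prop) (by fun_prop) (by fun_prop)
    · exact measurable_norm.comp (hV.comp measurable_snd)
    · exact Measurable.gk (by fun_prop) (by fun_prop) (by fun_prop)
  simp_rw [hSv]
  rw [lintegral_lintegral_lintegral_rotate (f := fun y s z =>
    ENNReal.ofReal (gk d s x z * |V z|) * ENNReal.ofReal (gk d (t - s) z y)) hm]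
  refine setLIntegral_congr_fun measurableSet_Ioo fun s hs => ?_
  refine lintegral_congr fun z => ?_
  rw [lintegral_const_mul' _ _ ENNReal.ofReal_ne_top, lintegral_gk d (sub_pos.2 hs.2), mul_one]

theorem lintegral_potential_le {d : ℕ} {V : EuclideanSpace ℝ (Fin d) → ℝ} (hV : Measurable V)
    {t : ℝ} (ht : 0 < t) (x : EuclideanSpace ℝ (Fin d)) {M : ℝ≥0∞}
    (hM : ∀ y, Sv d V t x y ≤ M) :
    ∫⁻ s in Set.Ioo 0 t, ∫⁻ z, ENNReal.ofReal (gk d s x z * |V z|) ≤ M :=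
  calc _ = ∫⁻ y, Sv d V t x y * ENNReal.ofReal (gk d t x y) :=
        (lintegral_Sv_mul_gk hV ht x).symm
    _ ≤ ∫⁻ y, M * ENNReal.ofReal (gk d t x y) := by gcongr with y; exact hM y
    _ = M := by
      rw [lintegral_const_mul _ (continuous_gk_right d t x).measurable.ennreal_ofReal,
        lintegral_gk d ht, mul_one]

theorem S_bounded_implies_potential_bounded
    (d : ℕ) (V : EuclideanSpace ℝ (Fin d) → ℝ) (hV : Measurable V) :
    -- (i) finiteness of `S(V,t,x,y)` at a single point implies local integrability of `V`
    ((∃ t : ℝ, 0 < t ∧ ∃ x y : EuclideanSpace ℝ (Fin d), Sv d V t x y < ⊤) →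
      LocallyIntegrable V volume) ∧
    -- (ii) the identity `∫ S(V,t,x,y) g(t,x,y) dy = ∫₀ᵗ ∫ g(s,x,z)|V(z)| dz ds`
    (∀ t : ℝ, 0 < t → ∀ x : EuclideanSpace ℝ (Fin d),
      ∫⁻ y, Sv d V t x y * ENNReal.ofReal (gk d t x y) =
        ∫⁻ s in Set.Ioo 0 t, ∫⁻ z, ENNReal.ofReal (gk d s x z * |V z|)) ∧
    -- (iii) local boundedness of bridge potentials implies local potential boundedness
    ((∀ T : ℝ, 0 < T →
      (⨆ (t : ℝ) (_ : t ∈ Set.Ioc (0 : ℝ) T) (x : EuclideanSpace ℝ (Fin d))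
          (y : EuclideanSpace ℝ (Fin d)), Sv d V t x y) < ⊤ →
      (⨆ x : EuclideanSpace ℝ (Fin d),
        ∫⁻ s in Set.Ioo 0 T, ∫⁻ z, ENNReal.ofReal (gk d s x z * |V z|)) < ⊤) ∧
     ((⨆ (t : ℝ) (_ : 0 < t) (x : EuclideanSpace ℝ (Fin d))
          (y : EuclideanSpace ℝ (Fin d)), Sv d V t x y) < ⊤ →
      (⨆ x : EuclideanSpace ℝ (Fin d),
        ∫⁻ s in Set.Ioi (0 : ℝ), ∫⁻ z, ENNReal.ofReal (gk d s x z * |V z|)) < ⊤)) := by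
  refine ⟨fun ⟨t, ht, x, y, h⟩ => locallyIntegrable_of_Sv_lt_top hV ht h,
    fun t ht x => lintegral_Sv_mul_gk hV ht x, fun T hT h => ?_, fun h => ?_⟩
  · refine (iSup_le fun x => ?_).trans_lt h
    exact lintegral_potential_le hV hT x fun y => le_iSup₂_of_le T ⟨hT, le_rfl⟩
      (le_iSup₂_of_le x y le_rfl)
  · refine (iSup_le fun x => ?_).trans_lt h
    have hU : Set.Ioi (0 : ℝ) = ⋃ n : ℕ, Set.Ioo (0 : ℝ) (n + 1) := by
      ext s
      simp only [Set.mem_Ioi, Set.mem_iUnion, Set.mem_Ioo, exists_and_left, iff_self_and]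
      exact fun _ => (exists_nat_gt s).imp fun n hn => hn.trans (lt_add_one _)
    have hmono : Monotone fun n : ℕ => Set.Ioo (0 : ℝ) (n + 1) := fun m n hmn =>
      Set.Ioo_subset_Ioo_right (by gcongr)
    rw [hU, setLIntegral_iUnion_of_directed _ hmono.directed_le]
    refine iSup_le fun n => ?_
    have hn : (0 : ℝ) < n + 1 := by positivity
    exact lintegral_potential_le hV hn x fun y => le_iSup₂_of_le (n + 1 : ℝ) hn
      (le_iSup₂_of_le x y le_rfl)
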